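/- Let ε > 0 with 6ε ≤ 1, and let (G, w) be an ε-coherent weighted graph, where G is hole-with-hat-free. Let (A, C, D, B) and (A', C', D', B') be fractures of G. Then either every connected induced subgraph of G[A ∪ A'] has vertex set contained in one of A, A', or the big component of G\(C ∪ D) equals the big component of G\(C' ∪ D'). -/

import Mathlib

open Finset

namespace EHhat

variable {V : Type*}

/-- `c : ZMod n → V` describes a hole (induced cycle of length `n ≥ 4`) in `G`. -/
def IsHole (G : SimpleGraph V) (n : ℕ) (c : ZMod n → V) : Prop :=
  4 ≤ n ∧ Function.Injective c ∧
    ∀ i j : ZMod n, G.Adj (c i) (c j) ↔ (i - j = 1 ∨ j - i = 1)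

/-- `G` contains a hole together with a hat: a vertex outside the hole with exactly
two neighbours on the hole, and these two neighbours are adjacent (consecutive). -/
def HasHoleWithHat (G : SimpleGraph V) : Prop :=
  ∃ (n : ℕ) (c : ZMod n → V) (v : V) (i : ZMod n),
    IsHole G n c ∧ (∀ j, v ≠ c j) ∧ (∀ j, G.Adj v (c j) ↔ (j = i ∨ j = i + 1))

def HoleWithHatFree (G : SimpleGraph V) : Prop := ¬ HasHoleWithHat G

/-- A graph is perfect if chromatic number equals clique number for
every induced subgraph. -/
def IsPerfect [Fintype V] (G : SimpleGraph V) : Prop :=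
  ∀ S : Finset V,
    (G.induce (S : Set V)).chromaticNumber = ((G.induce (S : Set V)).cliqueNum : ℕ∞)

/-- `f` is a good function on `G`: it is nonnegative and sums to at most 1 on
every perfect induced subgraph of `G`. -/
def GoodOn [Fintype V] (G : SimpleGraph V) (f : V → ℝ) : Prop :=
  (∀ v, 0 ≤ f v) ∧
  ∀ S : Finset V, IsPerfect (G.induce (S : Set V)) → ∑ v ∈ S, f v ≤ 1

/-- `G` is `α`-narrow if `∑ v, f v ^ α ≤ 1` for every good function `f` on `G`. -/
def Narrow [Fintype V] (G : SimpleGraph V) (α : ℝ) : Prop :=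
  ∀ f : V → ℝ, GoodOn G f → ∑ v, f v ^ α ≤ 1

/-- `(G, f)` is an `α`-critical pair. -/
def Critical [Fintype V] (G : SimpleGraph V) (f : V → ℝ) (α : ℝ) : Prop :=
  GoodOn G f ∧
  (∀ S : Finset V, S ≠ Finset.univ → Narrow (G.induce (S : Set V)) α) ∧
  1 < ∑ v, f v ^ α

/-- `A` is complete to `B`. -/
def CompleteTo (G : SimpleGraph V) (A B : Set V) : Prop :=
  ∀ a ∈ A, ∀ b ∈ B, G.Adj a b

/-- `A` is anticomplete to `B`. -/
def AnticompleteTo (G : SimpleGraph V) (A B : Set V) : Prop :=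
  ∀ a ∈ A, ∀ b ∈ B, ¬ G.Adj a b

/-- The vertex `v` is complete to the set `C`. -/
def VertCompleteTo (G : SimpleGraph V) (v : V) (C : Set V) : Prop :=
  ∀ c ∈ C, G.Adj v c

/-- The vertex `v` is mixed on `C`: it has both a neighbour and a non-neighbour in `C`. -/
def MixedOn (G : SimpleGraph V) (v : V) (C : Set V) : Prop :=
  (∃ c ∈ C, G.Adj v c) ∧ (∃ c ∈ C, ¬ G.Adj v c)

/-- `X ⊆ V(G)` is connected: `G[X]` is a connected graph. -/
def ConnSet (G : SimpleGraph V) (X : Set V) : Prop :=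
  (G.induce X).Connected

/-- `X ⊆ V(G)` is anticonnected: the complement of `G[X]` is a connected graph. -/
def AnticonnSet (G : SimpleGraph V) (X : Set V) : Prop :=
  ((G.induce X)ᶜ).Connected

/-- The sum of `f` over a set `X` of vertices. -/
noncomputable def setSum [Fintype V] (f : V → ℝ) (X : Set V) : ℝ :=
  ∑ v, X.indicator f v

/-- `w` is a weight function making `(G, w)` a weighted graph. -/
def IsWeight [Fintype V] (w : V → ℝ) : Prop :=
  (∀ v, 0 ≤ w v) ∧ ∑ v, w v = 1

/-- The weighted graph `(G, w)` is `ε`-coherent. -/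
def Coherent [Fintype V] (G : SimpleGraph V) (w : V → ℝ) (ε : ℝ) : Prop :=
  (∀ v, w v < ε) ∧
  (∀ v, setSum w (G.neighborSet v) < ε) ∧
  ∀ A B : Set V, Disjoint A B → AnticompleteTo G A B →
    min (setSum w A) (setSum w B) < ε

/-- `Y` is (the vertex set of) a component of `G[X]`: a maximal connected subset of `X`. -/
def IsCompOf (G : SimpleGraph V) (X Y : Set V) : Prop :=
  Y ⊆ X ∧ ConnSet G Y ∧
  ∀ Z : Set V, Y ⊆ Z → Z ⊆ X → ConnSet G Z → Z = Y

/-- `Y` is the big component of `G[X]` (with respect to the weight `w` and `ε`). -/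
def IsBigComp [Fintype V] (G : SimpleGraph V) (w : V → ℝ) (ε : ℝ) (X Y : Set V) : Prop :=
  IsCompOf G X Y ∧ setSum w X - ε < setSum w Y

/-- `v` is an attachment of `A`: a vertex outside `A` with a neighbour in `A`. -/
def IsAttachment (G : SimpleGraph V) (A : Set V) (v : V) : Prop :=
  v ∉ A ∧ ∃ a ∈ A, G.Adj v a

/-- `(C, D)` is a split of the weighted graph `(G, w)`. -/
def IsSplit [Fintype V] (G : SimpleGraph V) (w : V → ℝ) (ε : ℝ) (C D : Set V) : Prop :=
  Disjoint C D ∧ 2 ≤ C.ncard ∧ ConnSet G C ∧ AnticonnSet G C ∧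
  D.Nonempty ∧ D = {v | v ∉ C ∧ ∀ c ∈ C, G.Adj v c} ∧
  ∀ Y : Set V, IsBigComp G w ε ((C ∪ D)ᶜ) Y → ∀ c ∈ C, ¬ IsAttachment G Y c

/-- A split is optimal if its first part is maximal among splits. -/
def IsOptimalSplit [Fintype V] (G : SimpleGraph V) (w : V → ℝ) (ε : ℝ) (C D : Set V) : Prop :=
  IsSplit G w ε C D ∧ ∀ C' D' : Set V, IsSplit G w ε C' D' → C ⊆ C' → C' = C

/-- `(A, C, D, B)` is a fracture of `(G, w)`: `(C, D)` is an optimal split, `A` is the union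
of the components of `G \ (C ∪ D)` with an attachment in `C`, and `B` is the rest. -/
def IsFracture [Fintype V] (G : SimpleGraph V) (w : V → ℝ) (ε : ℝ)
    (A C D B : Set V) : Prop :=
  IsOptimalSplit G w ε C D ∧
  A = {v | ∃ Y : Set V, IsCompOf G ((C ∪ D)ᶜ) Y ∧ v ∈ Y ∧ ∃ c ∈ C, IsAttachment G Y c} ∧
  B = ((C ∪ D)ᶜ : Set V) \ A

/-- The generating relation for the forcer graph: vertices `0,1,2,3` and `4,5,6,7`
each induce a path, and the two quadruples are complete to each other. -/
def forcerRel (i j : Fin 8) : Prop :=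
  (i.val < 4 ∧ 4 ≤ j.val) ∨ j.val = i.val + 1

/-- The forcer graph. -/
def forcer : SimpleGraph (Fin 8) := SimpleGraph.fromRel forcerRel

def ForcerFree (G : SimpleGraph V) : Prop := IsEmpty (forcer ↪g G)

/-- Given an embedded copy of the forcer via the vertex map `f`, one of its two
constituent paths has all its vertices in `S`. -/
def ConstituentPathIn (f : Fin 8 → V) (S : Set V) : Prop :=
  (∀ i : Fin 8, i.val < 4 → f i ∈ S) ∨ (∀ i : Fin 8, 4 ≤ i.val → f i ∈ S)

/-- `X` is a homogeneous set of `H`. -/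
def IsHomogeneousSet {W : Type*} (H : SimpleGraph W) (X : Set W) : Prop :=
  ∀ v ∉ X, (∀ x ∈ X, H.Adj v x) ∨ (∀ x ∈ X, ¬ H.Adj v x)

/-- `H` is guarded: for each forcer in `H` there is a proper homogeneous set
containing a constituent path of the forcer. -/
def Guarded {W : Type*} (H : SimpleGraph W) : Prop :=
  ∀ f : forcer ↪g H, ∃ X : Set W,
    X ≠ Set.univ ∧ IsHomogeneousSet H X ∧ ConstituentPathIn (fun i => f i) X

/-- The house: the complement of the five-vertex path. -/
def house : SimpleGraph (Fin 5) := (SimpleGraph.pathGraph 5)ᶜ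

def HouseFree (G : SimpleGraph V) : Prop := IsEmpty (house ↪g G)

/-- `g` is a good function on the induced subgraph `G[X]`. -/
def GoodOnSub [Fintype V] (G : SimpleGraph V) (X : Set V) (g : V → ℝ) : Prop :=
  (∀ v ∈ X, 0 ≤ g v) ∧
  ∀ S : Finset V, (S : Set V) ⊆ X → IsPerfect (G.induce (S : Set V)) →
    ∑ v ∈ S, g v ≤ 1

section Connectivity

variable {V : Type*} {G : SimpleGraph V}

/-- A set is connected iff it is nonempty and any set that meets it and is closed under taking
neighbours inside it contains it. -/
theorem connSet_iff {X : Set V} :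
    ConnSet G X ↔ X.Nonempty ∧ ∀ S : Set V, (∃ x ∈ X, x ∈ S) →
      (∀ x ∈ X, x ∈ S → ∀ y ∈ X, G.Adj x y → y ∈ S) → X ⊆ S := by
  unfold ConnSet
  constructor
  · intro h
    refine ⟨Set.nonempty_coe_sort.1 h.nonempty, ?_⟩
    rintro S ⟨x, hx, hxS⟩ hcl y hy
    obtain ⟨p⟩ := h.preconnected ⟨x, hx⟩ ⟨y, hy⟩
    have key : ∀ (a b : X), (G.induce X).Walk a b → (a : V) ∈ S → (b : V) ∈ S := by
      intro a b p
      induction p with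
      | nil => exact id
      | cons hab _ ih => exact fun ha => ih (hcl _ (Subtype.prop _) ha _ (Subtype.prop _) hab)
    exact key _ _ p hxS
  · rintro ⟨hne, h⟩
    have : Nonempty X := hne.to_subtype
    refine SimpleGraph.Connected.mk ?_
    intro a b
    have := h {z | ∃ hz : z ∈ X, (G.induce X).Reachable a ⟨z, hz⟩} ⟨a, a.2, a.2, .refl _⟩ (by
      rintro x hx ⟨_, hr⟩ y hy hxy
      refine ⟨hy, hr.trans (SimpleGraph.Adj.reachable ?_)⟩
      exact hxy) b.2
    exact this.2

theorem anticonnSet_iff {X : Set V} : AnticonnSet G X ↔ ConnSet Gᶜ X := by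
  unfold AnticonnSet ConnSet
  have : (G.induce X)ᶜ = Gᶜ.induce X := by
    ext a b
    simp [Subtype.ext_iff]
  rw [this]

theorem ConnSet.nonempty {X : Set V} (h : ConnSet G X) : X.Nonempty := (connSet_iff.1 h).1

theorem ConnSet.subset_of_closed {X S : Set V} (h : ConnSet G X) {x : V} (hx : x ∈ X)
    (hxS : x ∈ S) (hcl : ∀ x ∈ X, x ∈ S → ∀ y ∈ X, G.Adj x y → y ∈ S) : X ⊆ S :=
  (connSet_iff.1 h).2 S ⟨x, hx, hxS⟩ hcl

/-- A connected set with a vertex in `S` and a vertex outside `S` has an edge leaving `S`. -/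
theorem ConnSet.exists_leaving {X S : Set V} (h : ConnSet G X) {x y : V} (hx : x ∈ X)
    (hxS : x ∈ S) (hy : y ∈ X) (hyS : y ∉ S) :
    ∃ a ∈ X, a ∈ S ∧ ∃ b ∈ X, b ∉ S ∧ G.Adj a b := by
  by_contra! hc
  exact hyS (h.subset_of_closed hx hxS (fun a ha haS b hb hab => by
    by_contra hbS; exact hc a ha haS b hb hbS hab) hy)

theorem connSet_singleton (x : V) : ConnSet G {x} := by
  rw [connSet_iff]
  refine ⟨⟨x, rfl⟩, ?_⟩
  rintro S ⟨_, rfl, hS⟩ - _ rfl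
  exact hS

theorem ConnSet.extend {X Z : Set V} (hX : ConnSet G X) (hXZ : X ⊆ Z)
    (h : ∀ z ∈ Z, z ∉ X → ∃ S, z ∈ S ∧ S ⊆ Z ∧ ConnSet G S ∧ ∃ s ∈ S, ∃ x ∈ X, G.Adj s x) :
    ConnSet G Z := by
  rw [connSet_iff]
  refine ⟨hX.nonempty.mono hXZ, ?_⟩
  rintro P ⟨z, hz, hzP⟩ hcl
  have hXP : X ⊆ P := by
    have sub : ∀ x ∈ X, x ∈ P → X ⊆ P := fun x hx hxP => hX.subset_of_closed hx hxP
      (fun a ha haP b hb hab => hcl a (hXZ ha) haP b (hXZ hb) hab)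
    by_cases hzX : z ∈ X
    · exact sub z hzX hzP
    · obtain ⟨S, hzS, hSZ, hS, s, hs, x, hx, hsx⟩ := h z hz hzX
      have hSP : S ⊆ P := hS.subset_of_closed hzS hzP
        (fun a ha haP b hb hab => hcl a (hSZ ha) haP b (hSZ hb) hab)
      exact sub x hx (hcl s (hSZ hs) (hSP hs) x (hXZ hx) hsx)
  intro y hy
  by_cases hyX : y ∈ X
  · exact hXP hyX
  · obtain ⟨S, hyS, hSZ, hS, s, hs, x, hx, hsx⟩ := h y hy hyX
    have hsP : s ∈ P := hcl x (hXZ hx) (hXP hx) s (hSZ hs) hsx.symm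
    exact hS.subset_of_closed hs hsP
      (fun a ha haP b hb hab => hcl a (hSZ ha) haP b (hSZ hb) hab) hyS

theorem ConnSet.extend_adj {X Z : Set V} (hX : ConnSet G X) (hXZ : X ⊆ Z)
    (h : ∀ z ∈ Z, z ∉ X → ∃ x ∈ X, G.Adj z x) : ConnSet G Z :=
  hX.extend hXZ fun z hz hzX =>
    ⟨{z}, rfl, Set.singleton_subset_iff.2 hz, connSet_singleton z, z, rfl, h z hz hzX⟩

theorem ConnSet.sUnion {F : Set (Set V)} {x : V} (hF : F.Nonempty)
    (h : ∀ S ∈ F, x ∈ S ∧ ConnSet G S) : ConnSet G (⋃₀ F) := by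
  rw [connSet_iff]
  obtain ⟨S₀, hS₀⟩ := hF
  refine ⟨⟨x, S₀, hS₀, (h S₀ hS₀).1⟩, ?_⟩
  rintro P ⟨z, ⟨S, hS, hzS⟩, hzP⟩ hcl
  have sub : ∀ T ∈ F, ∀ t ∈ T, t ∈ P → T ⊆ P := fun T hT t ht htP =>
    (h T hT).2.subset_of_closed ht htP
      (fun a ha haP b hb hab => hcl a ⟨T, hT, ha⟩ haP b ⟨T, hT, hb⟩ hab)
  have hxP : x ∈ P := sub S hS z hzS hzP (h S hS).1
  rintro y ⟨T, hT, hy⟩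
  exact sub T hT x (h T hT).1 hxP hy

theorem ConnSet.union {X Y : Set V} (hX : ConnSet G X) (hY : ConnSet G Y) {x : V}
    (hxX : x ∈ X) (hxY : x ∈ Y) : ConnSet G (X ∪ Y) := by
  rw [← Set.sUnion_pair]
  refine ConnSet.sUnion (x := x) ⟨X, by simp⟩ ?_
  rintro S (rfl | rfl)
  exacts [⟨hxX, hX⟩, ⟨hxY, hY⟩]

theorem IsCompOf.mem_of_adj {X Y : Set V} (h : IsCompOf G X Y) {y z : V} (hy : y ∈ Y)
    (hz : z ∈ X) (hyz : G.Adj y z) : z ∈ Y := by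
  have hc : ConnSet G (insert z Y) := h.2.1.extend_adj (Set.subset_insert z Y) (by
    rintro t (rfl | ht) htY
    exacts [⟨y, hy, hyz.symm⟩, absurd ht htY])
  rw [← h.2.2 _ (Set.subset_insert z Y) (Set.insert_subset hz h.1) hc]
  exact Set.mem_insert z Y

theorem IsCompOf.subset_of_mem {X Y S : Set V} (h : IsCompOf G X Y) (hS : ConnSet G S)
    (hSX : S ⊆ X) {x : V} (hxY : x ∈ Y) (hxS : x ∈ S) : S ⊆ Y := by
  have := h.2.2 (Y ∪ S) Set.subset_union_left (Set.union_subset h.1 hSX)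
    (h.2.1.union hS hxY hxS)
  exact Set.union_eq_left.1 this

theorem IsCompOf.eq_of_mem {X Y Z : Set V} (hY : IsCompOf G X Y) (hZ : IsCompOf G X Z) {x : V}
    (hxY : x ∈ Y) (hxZ : x ∈ Z) : Y = Z :=
  (hZ.subset_of_mem hY.2.1 hY.1 hxZ hxY).antisymm (hY.subset_of_mem hZ.2.1 hZ.1 hxY hxZ)

theorem exists_isCompOf {X : Set V} {x : V} (hx : x ∈ X) : ∃ Y, IsCompOf G X Y ∧ x ∈ Y := by
  have hxF : ({x} : Set V) ∈ {S : Set V | S ⊆ X ∧ x ∈ S ∧ ConnSet G S} :=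
    ⟨Set.singleton_subset_iff.2 hx, rfl, connSet_singleton x⟩
  have hx' : x ∈ ⋃₀ {S : Set V | S ⊆ X ∧ x ∈ S ∧ ConnSet G S} := ⟨_, hxF, rfl⟩
  refine ⟨_, ⟨Set.sUnion_subset fun S hS => hS.1,
    ConnSet.sUnion (x := x) ⟨_, hxF⟩ fun S hS => hS.2, fun Z hZ hZX hZc => ?_⟩, hx'⟩
  exact (Set.subset_sUnion_of_mem (S := {S : Set V | S ⊆ X ∧ x ∈ S ∧ ConnSet G S})
    ⟨hZX, hZ hx', hZc⟩).antisymm hZ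

end Connectivity

section Holes

variable {V : Type*} {G : SimpleGraph V}

/-- A hole with a hat, given by a sequence of vertices. -/
theorem hasHoleWithHat_of_seq {n : ℕ} (hn : 4 ≤ n) (g : ℕ → V) (x : V) (m : ℕ) (hm : m + 1 < n)
    (hinj : ∀ a b, a < b → b < n → g a ≠ g b)
    (hadj : ∀ a b, a < b → b < n → (G.Adj (g a) (g b) ↔ b = a + 1 ∨ (a = 0 ∧ b + 1 = n)))
    (hx : ∀ a < n, x ≠ g a) (hxadj : ∀ a < n, (G.Adj x (g a) ↔ a = m ∨ a = m + 1)) :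
    HasHoleWithHat G := by
  obtain ⟨k, rfl⟩ : ∃ k, n = k + 1 := ⟨n - 1, by omega⟩
  have hlt : ∀ i : ZMod (k + 1), i.val < k + 1 := fun i => ZMod.val_lt i
  have h1 : (1 : ZMod (k + 1)).val = 1 := by
    rw [ZMod.val_one_eq_one_mod, Nat.mod_eq_of_lt (by omega)]
  have hsub : ∀ i j : ZMod (k + 1), i - j = 1 ↔
      (i.val = j.val + 1 ∨ (j.val = k ∧ i.val = 0)) := by
    intro i j
    rw [sub_eq_iff_eq_add, ← (ZMod.val_injective (k + 1)).eq_iff, ZMod.val_add, h1]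
    have hi := hlt i
    have hj := hlt j
    rcases Nat.lt_or_ge (1 + j.val) (k + 1) with h | h
    · rw [Nat.mod_eq_of_lt h]; omega
    · have : 1 + j.val = k + 1 := by omega
      rw [this, Nat.mod_self]; omega
  refine ⟨k + 1, fun z => g z.val, x, (m : ZMod (k + 1)), ⟨hn, ?_, ?_⟩, ?_, ?_⟩
  · intro i j hij
    apply ZMod.val_injective
    rcases lt_trichotomy i.val j.val with h | h | h
    · exact absurd hij (hinj _ _ h (hlt j))
    · exact h
    · exact absurd hij.symm (hinj _ _ h (hlt i))
  · intro i j
    have hi := hlt i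
    have hj := hlt j
    rw [hsub, hsub]
    rcases lt_trichotomy i.val j.val with h | h | h
    · rw [hadj _ _ h hj]; omega
    · have hij : ¬ G.Adj (g i.val) (g j.val) := by rw [h]; exact G.irrefl
      refine iff_of_false hij ?_
      omega
    · rw [G.adj_comm, hadj _ _ h hi]; omega
  · exact fun j => hx _ (hlt j)
  · intro j
    have hmv : (m : ZMod (k + 1)).val = m := ZMod.val_cast_of_lt (by omega)
    have hmv' : ((m : ZMod (k + 1)) + 1).val = m + 1 := by
      rw [ZMod.val_add, hmv, h1, Nat.mod_eq_of_lt hm]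
    rw [hxadj _ (hlt j), ← (ZMod.val_injective (k + 1)).eq_iff,
      ← (ZMod.val_injective (k + 1)).eq_iff, hmv, hmv']

/-- A hole of length four with vertices `a, b, c, d` in order, with a hat `x` on `a, b`. -/
theorem hasHoleWithHat_of_four {a b c d x : V} (hab : G.Adj a b) (hbc : G.Adj b c)
    (hcd : G.Adj c d) (hda : G.Adj d a) (hac : ¬ G.Adj a c) (hbd : ¬ G.Adj b d)
    (hxa : G.Adj x a) (hxb : G.Adj x b) (hxc : ¬ G.Adj x c) (hxd : ¬ G.Adj x d) :
    HasHoleWithHat G := by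
  have hac' : a ≠ c := by rintro rfl; exact hxc hxa
  have hbd' : b ≠ d := by rintro rfl; exact hxd hxb
  have hxc' : x ≠ c := by rintro rfl; exact hac hxa.symm
  have hxd' : x ≠ d := by rintro rfl; exact hbd hxb.symm
  refine hasHoleWithHat_of_seq (n := 4) le_rfl
    (fun i => if i = 0 then a else if i = 1 then b else if i = 2 then c else d) x 0
    (by norm_num) ?_ ?_ ?_ ?_
  · intro i j hij hj
    interval_cases j <;> interval_cases i <;>
      simp [hab.ne, hbc.ne, hcd.ne, hda.ne', hac', hbd']
  · intro i j hij hj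
    interval_cases j <;> interval_cases i <;> simp [hab, hbc, hcd, hda.symm, hac, hbd]
  · intro i hi
    interval_cases i <;> simp [hxa.ne, hxb.ne, hxc', hxd']
  · intro i hi
    interval_cases i <;> simp [hxa, hxb, hxc, hxd]

/-- A connected set `T` meeting two sets contains a shortest path between them. -/
theorem ConnSet.exists_shortest_path {T P Q : Set V} (hT : ConnSet G T)
    (hP : ∃ x ∈ T, x ∈ P) (hQ : ∃ x ∈ T, x ∈ Q) :
    ∃ (k : ℕ) (f : ℕ → V), (∀ i ≤ k, f i ∈ T) ∧
      (∀ i ≤ k, f i ∈ P ↔ i = 0) ∧ (∀ i ≤ k, f i ∈ Q ↔ i = k) ∧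
      ∀ i j, i < j → j ≤ k → f i ≠ f j ∧ (G.Adj (f i) (f j) ↔ j = i + 1) := by
  classical
  let good : ℕ → (ℕ → V) → Prop := fun k f =>
    f 0 ∈ P ∧ (∀ i ≤ k, f i ∈ T) ∧ ∀ i < k, G.Adj (f i) (f (i + 1))
  have hex : ∃ k f, good k f ∧ f k ∈ Q := by
    obtain ⟨x, hx, hxP⟩ := hP
    obtain ⟨y, hy, hyQ⟩ := hQ
    have : T ⊆ {z | ∃ k f, good k f ∧ f k = z} := by
      refine hT.subset_of_closed hx ⟨0, fun _ => x, ⟨hxP, fun _ _ => hx, by simp⟩, rfl⟩ ?_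
      rintro a ha ⟨k, f, ⟨h0, h1, h2⟩, rfl⟩ b hb hab
      refine ⟨k + 1, fun i => if i ≤ k then f i else b, ⟨by simpa using h0, ?_, ?_⟩, by simp⟩
      · intro i hi
        dsimp only
        split_ifs with h
        exacts [h1 i h, hb]
      · intro i hi
        rcases Nat.lt_or_ge i k with h | h
        · simpa [h.le, Nat.succ_le_of_lt h] using h2 i h
        · obtain rfl : i = k := by omega
          simpa using hab
    obtain ⟨k, f, hf, hk⟩ := this hy
    exact ⟨k, f, hf, hk ▸ hyQ⟩
  obtain ⟨f, hf, hfQ⟩ := Nat.find_spec hex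
  have hmin : ∀ m g, good m g → g m ∈ Q → Nat.find hex ≤ m := fun m g h1 h2 =>
    Nat.find_min' hex ⟨g, h1, h2⟩
  set k := Nat.find hex
  obtain ⟨h0, h1, h2⟩ := hf
  have hQk : ∀ i ≤ k, f i ∈ Q → i = k := fun i hi hiQ => by
    have := hmin i f ⟨h0, fun j hj => h1 j (hj.trans hi), fun j hj => h2 j (hj.trans_le hi)⟩ hiQ
    omega
  have hP0 : ∀ i ≤ k, f i ∈ P → i = 0 := fun i hi hiP => by
    have := hmin (k - i) (fun j => f (j + i)) ⟨by simpa using hiP, fun j hj => h1 _ (by omega),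
      fun j hj => by
        have := h2 (j + i) (by omega)
        rwa [show j + i + 1 = j + 1 + i by omega] at this⟩ (by
        simpa [Nat.sub_add_cancel hi] using hfQ)
    omega
  have hshort : ∀ i j, i < j → j ≤ k → G.Adj (f i) (f j) → j = i + 1 := by
    intro i j hij hj hadj
    by_contra hne
    have := hmin (k - (j - i - 1)) (fun t => if t ≤ i then f t else f (t + (j - i - 1)))
      ⟨by simpa using h0, ?_, ?_⟩ ?_
    · omega
    · intro t ht
      dsimp only
      split_ifs
      exacts [h1 _ (by omega), h1 _ (by omega)]
    · intro t ht
      rcases lt_trichotomy t i with h | h | h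
      · simpa [h.le, Nat.succ_le_of_lt h] using h2 t (by omega)
      · subst h
        simpa [show t + 1 + (j - t - 1) = j by omega] using hadj
      · have := h2 (t + (j - i - 1)) (by omega)
        rw [show t + (j - i - 1) + 1 = t + 1 + (j - i - 1) by omega] at this
        simpa [show ¬ t ≤ i by omega, show ¬ t + 1 ≤ i by omega] using this
    · rw [if_neg (by omega), show k - (j - i - 1) + (j - i - 1) = k by omega]
      exact hfQ
  refine ⟨k, f, h1, fun i hi => ⟨hP0 i hi, fun h => h ▸ h0⟩,
    fun i hi => ⟨hQk i hi, fun h => h ▸ hfQ⟩, fun i j hij hj => ⟨fun heq => ?_,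
      hshort i j hij hj, fun h => h ▸ h2 i (by omega)⟩⟩
  rcases Nat.lt_or_ge j k with h | h
  · have := hshort i (j + 1) (by omega) (by omega) (heq ▸ h2 j h)
    omega
  · obtain rfl : j = k := by omega
    have := hQk i (by omega) (heq ▸ hfQ)
    omega

/-- In a hole-with-hat-free graph, if `h` is complete to the connected set `C` and attached to
the connected set `T`, and `T` is attached to `C` but no vertex of `T` is complete to `C`, then
some neighbour of `h` in `T` has a neighbour in `C`. -/
theorem exists_adj_attached (hG : HoleWithHatFree G) {C T : Set V} {h : V}
    (hC : ConnSet G C) (hT : ConnSet G T) (hdisj : ∀ t ∈ T, t ∉ C)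
    (hhT : h ∉ T) (hh : ∀ c ∈ C, G.Adj h c) (hhadj : ∃ t ∈ T, G.Adj h t)
    (hatt : ∃ t ∈ T, ∃ c ∈ C, G.Adj t c) (hmixed : ∀ t ∈ T, ∃ c ∈ C, ¬ G.Adj t c) :
    ∃ t ∈ T, G.Adj h t ∧ ∃ c ∈ C, G.Adj t c := by
  obtain ⟨k, f, hfT, hfP, hfQ, hf⟩ := hT.exists_shortest_path
    (P := {t | G.Adj h t}) (Q := {t | ∃ c ∈ C, G.Adj t c}) hhadj hatt
  simp only [Set.mem_ofPred_eq] at hfP hfQ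
  by_cases hk : k = 0
  · exact ⟨f 0, hfT 0 (by omega), (hfP 0 (by omega)).2 rfl, (hfQ 0 (by omega)).2 hk.symm⟩
  exfalso
  obtain ⟨s₀, hs₀, hks₀⟩ := (hfQ k le_rfl).2 rfl
  obtain ⟨r₀, hr₀, hkr₀⟩ := hmixed (f k) (hfT k le_rfl)
  obtain ⟨s, hs, hks, r, hr, hkr, hsr⟩ :=
    hC.exists_leaving (S := {c | G.Adj (f k) c}) hs₀ hks₀ hr₀ hkr₀
  simp only [Set.mem_ofPred_eq] at hks hkr
  have hfs : ∀ i ≤ k, G.Adj (f i) s ↔ i = k := fun i hi =>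
    ⟨fun h => (hfQ i hi).1 ⟨s, hs, h⟩, fun h => h ▸ hks⟩
  have hfr : ∀ i ≤ k, ¬ G.Adj (f i) r := fun i hi h => by
    obtain rfl := (hfQ i hi).1 ⟨r, hr, h⟩
    exact hkr h
  have hfs' : ∀ i ≤ k, f i ≠ s := fun i hi h => hdisj _ (hfT i hi) (h ▸ hs)
  have hfr' : ∀ i ≤ k, f i ≠ r := fun i hi h => hdisj _ (hfT i hi) (h ▸ hr)
  have hfh' : ∀ i ≤ k, f i ≠ h := fun i hi e => hhT (e ▸ hfT i hi)
  refine hG (hasHoleWithHat_of_seq (n := k + 3) (by omega)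
    (fun i => if i ≤ k then f i else if i = k + 1 then s else h) r (k + 1) (by omega) ?_ ?_ ?_ ?_)
  · intro a b hab hb
    rcases Nat.lt_or_ge k b with h1 | h1
    · rcases Nat.lt_or_ge k a with h2 | h2
      · simp [show a = k + 1 by omega, show b = k + 2 by omega, (hh s hs).ne']
      · by_cases h3 : b = k + 1
        · simp [h3, h2, hfs']
        · simp [h3, h2, hfh', show ¬ b ≤ k by omega]
    · simpa [h1, show a ≤ k by omega] using (hf a b hab h1).1
  · intro a b hab hb
    rcases Nat.lt_or_ge k b with h1 | h1
    · rcases Nat.lt_or_ge k a with h2 | h2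
      · simp [show a = k + 1 by omega, show b = k + 2 by omega, (hh s hs).symm]
      · by_cases h3 : b = k + 1
        · simp only [h3, h2, if_true, hfs a h2, show ¬ k + 1 ≤ k by omega, if_false]
          omega
        · simp only [h3, h2, if_true, show ¬ b ≤ k by omega, if_false, G.adj_comm (f a) h,
            hfP a h2]
          omega
    · simp only [h1, show a ≤ k by omega, if_true, (hf a b hab h1).2]
      omega
  · intro a ha
    split_ifs with h1 h2
    exacts [(hfr' a h1).symm, hsr.ne', (hh r hr).ne']
  · intro a ha
    split_ifs with h1 h2
    · simp only [G.adj_comm r, hfr a h1, false_iff]; omega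
    · simp [hsr.symm, h2]
    · simp only [(hh r hr).symm, true_iff]; omega

end Holes

section Weights

variable {V : Type*} [Fintype V] {G : SimpleGraph V} {w : V → ℝ} {ε : ℝ}

theorem setSum_mono (hw : ∀ v, 0 ≤ w v) {X Y : Set V} (h : X ⊆ Y) : setSum w X ≤ setSum w Y :=
  Finset.sum_le_sum fun _ _ => Set.indicator_le_indicator_of_subset h hw _

theorem setSum_compl_union_ge (hw : IsWeight w) (X Y : Set V) :
    1 - setSum w X - setSum w Y ≤ setSum w (X ∪ Y)ᶜ := by
  classical
  unfold setSum
  rw [← hw.2, ← Finset.sum_sub_distrib, ← Finset.sum_sub_distrib]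
  refine Finset.sum_le_sum fun v _ => ?_
  have := hw.1 v
  by_cases h1 : v ∈ X <;> by_cases h2 : v ∈ Y <;> simp [h1, h2, this]

theorem exists_mem_of_setSum_add (hw : IsWeight w) {X Y : Set V}
    (h : 1 < setSum w X + setSum w Y) : ∃ v ∈ X, v ∈ Y := by
  classical
  by_contra! hc
  refine h.not_ge ?_
  unfold setSum
  rw [← hw.2, ← Finset.sum_add_distrib]
  refine Finset.sum_le_sum fun v _ => ?_
  have := hw.1 v
  by_cases h1 : v ∈ X
  · simp [h1, hc v h1]
  · by_cases h2 : v ∈ Y <;> simp [h1, h2, this]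

/-- The set removed by a split has weight less than `2ε`, so every big component is heavy. -/
theorem IsBigComp.weight_gt (hw : IsWeight w) (hcoh : Coherent G w ε) {C D Y : Set V}
    (hC : C.Nonempty) (hD : D.Nonempty) (hCD : ∀ d ∈ D, ∀ c ∈ C, G.Adj d c)
    (hY : IsBigComp G w ε (C ∪ D)ᶜ Y) : 1 - 3 * ε < setSum w Y := by
  obtain ⟨c, hc⟩ := hC
  obtain ⟨d, hd⟩ := hD
  have h1 : setSum w C < ε :=
    (setSum_mono hw.1 fun x hx => hCD d hd x hx).trans_lt (hcoh.2.1 d)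
  have h2 : setSum w D < ε :=
    (setSum_mono hw.1 fun x hx => (hCD x hx c hc).symm).trans_lt (hcoh.2.1 c)
  have h3 := setSum_compl_union_ge hw C D
  have h4 := hY.2
  linarith

end Weights

section Fractures

variable {V : Type*} {G : SimpleGraph V}

/-- The combinatorial properties of a fracture `(A, C, D, B)` and the big component `Y` of
`G \ (C ∪ D)` that do not refer to weights, for a predicate `Split` on pairs of sets. -/
structure FractureData (G : SimpleGraph V) (Split : Set V → Set V → Prop)
    (A C D Y : Set V) : Prop where
  connC : ConnSet G C
  anticonnC : ConnSet Gᶜ C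
  nonempty_D : D.Nonempty
  mem_D : ∀ x, x ∈ D ↔ x ∉ C ∧ ∀ c ∈ C, G.Adj x c
  A_notMem_C : ∀ a ∈ A, a ∉ C
  A_notMem_D : ∀ a ∈ A, a ∉ D
  A_notMem_Y : ∀ a ∈ A, a ∉ Y
  A_closed : ∀ a ∈ A, ∀ z, G.Adj a z → z ∈ A ∨ z ∈ C ∨ z ∈ D
  A_attached : ∀ a ∈ A, ∃ T ⊆ A, ConnSet G T ∧ a ∈ T ∧ ∃ t ∈ T, ∃ c ∈ C, G.Adj t c
  connY : ConnSet G Y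
  Y_notMem_C : ∀ y ∈ Y, y ∉ C
  Y_notMem_D : ∀ y ∈ Y, y ∉ D
  Y_closed : ∀ y ∈ Y, ∀ z, G.Adj y z → z ∈ Y ∨ z ∈ D
  split : Split C D
  optimal : ∀ C₁ D₁, Split C₁ D₁ → C ⊆ C₁ → C₁ = C
  eq_of_superset : ∀ C₁ D₁ : Set V, ConnSet G C₁ → ConnSet Gᶜ C₁ → C ⊆ C₁ → D₁.Nonempty →
    (∀ x, x ∈ D₁ ↔ x ∉ C₁ ∧ ∀ c ∈ C₁, G.Adj x c) → (∀ y ∈ Y, y ∉ C₁) →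
    (∀ y ∈ Y, ∀ z, G.Adj y z → z ∈ Y ∨ z ∈ D₁) → C₁ = C

theorem IsFracture.fractureData [Fintype V] {w : V → ℝ} {ε : ℝ} (h6 : 6 * ε ≤ 1)
    (hw : IsWeight w) (hcoh : Coherent G w ε) {A C D B Y : Set V}
    (h : IsFracture G w ε A C D B) (hY : IsBigComp G w ε (C ∪ D)ᶜ Y) :
    FractureData G (IsSplit G w ε) A C D Y ∧ 1 - 3 * ε < setSum w Y := by
  obtain ⟨⟨hsplit, hopt⟩, hA, -⟩ := h
  have ⟨hdisj, hcard, hconn, hanti, hDne, hD, hatt⟩ := hsplit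
  have hCne := hconn.nonempty
  have mem_D : ∀ x, x ∈ D ↔ x ∉ C ∧ ∀ c ∈ C, G.Adj x c := fun x => by
    rw [hD]; rfl
  have hYw := hY.weight_gt hw hcoh hCne hDne fun d hd => ((mem_D d).1 hd).2
  have hYX := hY.1.1
  have Y_notMem_C : ∀ y ∈ Y, y ∉ C := fun y hy hc => hYX hy (Or.inl hc)
  have Y_notMem_D : ∀ y ∈ Y, y ∉ D := fun y hy hd => hYX hy (Or.inr hd)
  have Y_C : ∀ y ∈ Y, ∀ c ∈ C, ¬ G.Adj y c := fun y hy c hc hyc =>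
    hatt Y hY c hc ⟨fun hcY => Y_notMem_C c hcY hc, y, hy, hyc.symm⟩
  have Y_closed : ∀ y ∈ Y, ∀ z, G.Adj y z → z ∈ Y ∨ z ∈ D := fun y hy z hyz => by
    by_cases hz : z ∈ (C ∪ D)ᶜ
    · exact Or.inl (hY.1.mem_of_adj hy hz hyz)
    · rcases not_not.1 hz with hz | hz
      exacts [absurd hyz (Y_C y hy z hz), Or.inr hz]
  have hA' : ∀ a ∈ A, ∃ Z : Set V, IsCompOf G (C ∪ D)ᶜ Z ∧ a ∈ Z ∧ Z ⊆ A ∧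
      ∃ t ∈ Z, ∃ c ∈ C, G.Adj t c := by
    intro a ha
    rw [hA] at ha ⊢
    obtain ⟨Z, hZ, haZ, c, hc, hca, z, hz, hcz⟩ := ha
    exact ⟨Z, hZ, haZ, fun x hx => ⟨Z, hZ, hx, c, hc, hca, z, hz, hcz⟩, z, hz, c, hc, hcz.symm⟩
  refine ⟨⟨hconn, anticonnSet_iff.1 hanti, hDne, mem_D, ?_, ?_, ?_, ?_, ?_, hY.1.2.1, Y_notMem_C,
    Y_notMem_D, Y_closed, hsplit, hopt, ?_⟩, hYw⟩
  · intro a ha hc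
    obtain ⟨Z, hZ, haZ, -⟩ := hA' a ha
    exact hZ.1 haZ (Or.inl hc)
  · intro a ha hd
    obtain ⟨Z, hZ, haZ, -⟩ := hA' a ha
    exact hZ.1 haZ (Or.inr hd)
  · intro a ha haY
    obtain ⟨Z, hZ, haZ, -, t, ht, c, hc, htc⟩ := hA' a ha
    obtain rfl := hZ.eq_of_mem hY.1 haZ haY
    exact Y_C t ht c hc htc
  · intro a ha z haz
    obtain ⟨Z, hZ, haZ, hZA, -⟩ := hA' a ha
    by_cases hz : z ∈ (C ∪ D)ᶜ
    · exact Or.inl (hZA (hZ.mem_of_adj haZ hz haz))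
    · exact Or.inr (not_not.1 hz)
  · intro a ha
    obtain ⟨Z, hZ, haZ, hZA, hZc⟩ := hA' a ha
    exact ⟨Z, hZA, hZ.2.1, haZ, hZc⟩
  · intro C₁ D₁ hC₁ hC₁' hCC₁ hD₁ne hD₁ hYC₁ hYD₁
    have hYX₁ : Y ⊆ (C₁ ∪ D₁)ᶜ := by
      rintro y hy (h | h)
      · exact hYC₁ y hy h
      · obtain ⟨c, hc⟩ := hCne
        exact Y_C y hy c hc (((hD₁ y).1 h).2 c (hCC₁ hc))
    refine hopt C₁ D₁ ⟨Set.disjoint_left.2 fun x hx hx' => ((hD₁ x).1 hx').1 hx,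
      hcard.trans (Set.ncard_le_ncard hCC₁), hC₁, anticonnSet_iff.2 hC₁', hD₁ne,
      Set.ext hD₁, ?_⟩ hCC₁
    rintro Y₁ hY₁ c hc ⟨-, y, hy, hcy⟩
    have hY₁w := hY₁.weight_gt hw hcoh hC₁.nonempty hD₁ne fun d hd => ((hD₁ d).1 hd).2
    obtain ⟨u, hu, hu₁⟩ := exists_mem_of_setSum_add hw (X := Y) (Y := Y₁) (by linarith)
    have hsub : Y₁ ⊆ Y := hY₁.1.2.1.subset_of_closed hu₁ hu fun a _ haY b hb hab =>
      (hYD₁ a haY b hab).resolve_right fun h => hY₁.1.1 hb (Or.inr h)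
    rcases hYD₁ y (hsub hy) c hcy.symm with h | h
    exacts [hYC₁ c h hc, ((hD₁ c).1 h).1 hc]

namespace FractureData

variable {Split : Set V → Set V → Prop} {A C D Y A' C' D' Y' : Set V}

theorem not_adj_of_Y_of_C (H : FractureData G Split A C D Y) {y c : V} (hy : y ∈ Y)
    (hc : c ∈ C) : ¬ G.Adj y c := fun h => by
  rcases H.Y_closed y hy c h with h | h
  exacts [H.Y_notMem_C c h hc, ((H.mem_D c).1 h).1 hc]

theorem not_adj_of_A_of_Y (H : FractureData G Split A C D Y) {a y : V} (ha : a ∈ A)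
    (hy : y ∈ Y) : ¬ G.Adj a y := fun h => by
  rcases H.A_closed a ha y h with h | h | h
  exacts [H.A_notMem_Y y h hy, H.Y_notMem_C y hy h, H.Y_notMem_D y hy h]

theorem adj_of_D_of_C (H : FractureData G Split A C D Y) {d c : V} (hd : d ∈ D)
    (hc : c ∈ C) : G.Adj d c := ((H.mem_D d).1 hd).2 c hc

/-- In a hole-with-hat-free graph, for `v` mixed on `C`, vertices of `D` adjacent to `v` are
adjacent to all vertices of `D` nonadjacent to `v`. -/
theorem adj_of_mixedOn (hG : HoleWithHatFree G) (H : FractureData G Split A C D Y) {v d d₁ : V}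
    (hmix : MixedOn G v C) (hd : d ∈ D) (hd₁ : d₁ ∈ D) (hvd : ¬ G.Adj v d)
    (hvd₁ : G.Adj v d₁) : G.Adj d d₁ := by
  obtain ⟨⟨s, hs, hvs⟩, r, hr, hvr⟩ := hmix
  obtain ⟨c, hc, hvc, c₃, hc₃, hvc₃, hcc₃⟩ :=
    H.anticonnC.exists_leaving (S := {c | G.Adj v c}) hs hvs hr hvr
  by_contra hdd
  exact hG (hasHoleWithHat_of_four (a := d₁) (b := c) (c := d) (d := c₃) (x := v)
    (H.adj_of_D_of_C hd₁ hc) (H.adj_of_D_of_C hd hc).symm (H.adj_of_D_of_C hd hc₃)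
    (H.adj_of_D_of_C hd₁ hc₃).symm (fun h => hdd h.symm)
    ((SimpleGraph.compl_adj _ _ _).1 hcc₃).2 hvd₁ hvc hvd hvc₃)

/-- If `C ∪ D` meets the set `A'` of another fracture, then `C` is disjoint from the big component
of that other fracture. -/
theorem notMem_of_mem_C (H : FractureData G Split A C D Y) (H' : FractureData G Split A' C' D' Y')
    (hA' : ∃ z ∈ A', z ∈ C ∨ z ∈ D) : ∀ c ∈ C, c ∉ Y' := by
  intro c₀ hc₀ hc₀Y'
  have hD : ∀ d ∈ D, d ∈ Y' ∨ d ∈ D' := fun d hd =>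
    H'.Y_closed c₀ hc₀Y' d (H.adj_of_D_of_C hd hc₀).symm
  obtain ⟨a', ha', ha'C⟩ : ∃ a' ∈ A', a' ∈ C := by
    obtain ⟨z, hz, h | h⟩ := hA'
    · exact ⟨z, hz, h⟩
    · rcases hD z h with h | h
      exacts [absurd h (H'.A_notMem_Y z hz), absurd h (H'.A_notMem_D z hz)]
  have hDD' : D ⊆ D' := fun d hd => (hD d hd).resolve_left fun h =>
    H'.not_adj_of_A_of_Y ha' h (H.adj_of_D_of_C hd ha'C).symm
  obtain ⟨x, hx, hxY', c₁, hc₁, hc₁Y', hxc₁⟩ :=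
    H.connC.exists_leaving (S := Y') hc₀ hc₀Y' ha'C (H'.A_notMem_Y a' ha')
  have hc₁D' : c₁ ∈ D' := (H'.Y_closed x hxY' c₁ hxc₁).resolve_left hc₁Y'
  have hC'D : ∀ c ∈ C', c ∉ D := fun c hc hd => ((H'.mem_D c).1 (hDD' hd)).1 hc
  have hC'Y : ∀ c ∈ C', c ∉ Y := fun c hc hY =>
    H.not_adj_of_Y_of_C hY hc₁ (H'.adj_of_D_of_C hc₁D' hc).symm
  have hunion : C ∪ C' = C := by
    refine H.eq_of_superset (C ∪ C') D ?_ ?_ Set.subset_union_left ?_ ?_ ?_ H.Y_closed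
    · refine H.connC.extend_adj Set.subset_union_left ?_
      rintro z (hz | hz) hzC
      exacts [absurd hz hzC, ⟨c₁, hc₁, (H'.adj_of_D_of_C hc₁D' hz).symm⟩]
    · refine H.anticonnC.extend_adj Set.subset_union_left ?_
      rintro z (hz | hz) hzC
      · exact absurd hz hzC
      · refine ⟨c₀, hc₀, (SimpleGraph.compl_adj _ _ _).2 ⟨?_, fun h => ?_⟩⟩
        · rintro rfl
          exact hzC hc₀
        · exact H'.not_adj_of_Y_of_C hc₀Y' hz h.symm
    · exact H.nonempty_D
    · intro d
      constructor
      · refine fun hd => ⟨?_, ?_⟩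
        · rintro (h | h)
          exacts [((H.mem_D d).1 hd).1 h, hC'D d h hd]
        · rintro c (h | h)
          exacts [H.adj_of_D_of_C hd h, H'.adj_of_D_of_C (hDD' hd) h]
      · rintro ⟨h1, h2⟩
        exact (H.mem_D d).2 ⟨fun h => h1 (Or.inl h), fun c hc => h2 c (Or.inl hc)⟩
    · rintro y hy (h | h)
      exacts [H.Y_notMem_C y hy h, hC'Y y h hy]
  have hCC' := H'.optimal C D H.split (Set.union_eq_left.1 hunion)
  exact H'.Y_notMem_C c₀ hc₀Y' (hCC' ▸ hc₀)

/-- Some vertex of `A` has a neighbour in `C` and is complete to `C'`, provided that `C'` is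
contained in `D` and some vertex of `A` is complete to `C'`. -/
theorem exists_mem_A_complete (hG : HoleWithHatFree G) (H : FractureData G Split A C D Y)
    (hC' : ConnSet Gᶜ C') (hC'D : C' ⊆ D) (ha : ∃ a ∈ A, ∀ c ∈ C', G.Adj a c) :
    ∃ v ∈ A, MixedOn G v C ∧ ∀ c ∈ C', G.Adj v c := by
  obtain ⟨a, ha, hac⟩ := ha
  obtain ⟨h, hh⟩ := hC'.nonempty
  obtain ⟨T, hTA, hT, haT, hatt⟩ := H.A_attached a ha
  have hmix : ∀ t ∈ T, ∃ c ∈ C, ¬ G.Adj t c := fun t ht => by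
    by_contra! hc
    exact H.A_notMem_D t (hTA ht) ((H.mem_D t).2 ⟨H.A_notMem_C t (hTA ht), hc⟩)
  obtain ⟨v, hv, hhv, hvC⟩ := exists_adj_attached hG H.connC hT
    (fun t ht => H.A_notMem_C t (hTA ht)) (fun hhT => H.A_notMem_D h (hTA hhT) (hC'D hh))
    (fun c hc => H.adj_of_D_of_C (hC'D hh) hc) ⟨a, haT, (hac h hh).symm⟩ hatt hmix
  refine ⟨v, hTA hv, ⟨hvC, hmix v hv⟩, ?_⟩
  refine hC'.subset_of_closed (S := {c | G.Adj v c}) hh hhv.symm ?_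
  intro c hc hvc c₁ hc₁ hcc₁
  by_contra hvc₁
  exact ((SimpleGraph.compl_adj _ _ _).1 hcc₁).2
    (H.adj_of_mixedOn hG ⟨hvC, hmix v hv⟩ (hC'D hc₁) (hC'D hc) hvc₁ hvc).symm

/-- If `v ∈ A` is mixed on `C` and complete to a nonempty subset of `D`, then some vertex of `D`
nonadjacent to `v` has a neighbour in the big component. -/
theorem exists_nonadj_attached (H : FractureData G Split A C D Y) {v : V} (hv : v ∈ A)
    (hmix : MixedOn G v C) (hne : ∃ d ∈ D, G.Adj v d) :
    ∃ d ∈ D, ¬ G.Adj v d ∧ ∃ y ∈ Y, G.Adj y d := by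
  by_contra! hc
  have hvC := H.A_notMem_C v hv
  obtain ⟨d₀, hd₀, hvd₀⟩ := hne
  have : insert v C = C := by
    refine H.eq_of_superset (insert v C) {d | d ∈ D ∧ G.Adj v d} ?_ ?_ (Set.subset_insert v C)
      ⟨d₀, hd₀, hvd₀⟩ ?_ ?_ ?_
    · refine H.connC.extend_adj (Set.subset_insert v C) ?_
      rintro z (rfl | hz) hzC
      exacts [hmix.1, absurd hz hzC]
    · refine H.anticonnC.extend_adj (Set.subset_insert v C) ?_
      rintro z (rfl | hz) hzC
      · obtain ⟨c, hc, hzc⟩ := hmix.2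
        exact ⟨c, hc, (SimpleGraph.compl_adj _ _ _).2 ⟨fun h => hzC (h ▸ hc), hzc⟩⟩
      · exact absurd hz hzC
    · intro d
      constructor
      · rintro ⟨hd, hvd⟩
        refine ⟨?_, ?_⟩
        · rintro (rfl | h)
          exacts [G.irrefl hvd, ((H.mem_D d).1 hd).1 h]
        · rintro c (rfl | h)
          exacts [hvd.symm, H.adj_of_D_of_C hd h]
      · rintro ⟨h1, h2⟩
        exact ⟨(H.mem_D d).2 ⟨fun h => h1 (Or.inr h), fun c hc => h2 c (Or.inr hc)⟩,
          (h2 v (Or.inl rfl)).symm⟩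
    · rintro y hy (rfl | h)
      exacts [H.A_notMem_Y y hv hy, H.Y_notMem_C y hy h]
    · intro y hy z hyz
      refine (H.Y_closed y hy z hyz).imp_right fun hz => ⟨hz, ?_⟩
      by_contra hvz
      exact hc z hz hvz y hy hyz
  exact hvC (this ▸ Set.mem_insert v C)

/-- A neighbour in the big component of a vertex `h ∈ D` adjacent to `v` can be connected, inside
the neighbourhood of `h`, to a vertex attached to a vertex of `D` nonadjacent to `v`. -/
theorem exists_connSet_attached (hG : HoleWithHatFree G) (H : FractureData G Split A C D Y)
    {v h u : V} (hv : v ∈ A) (hmix : MixedOn G v C) (hh : h ∈ D) (hvh : G.Adj v h)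
    (hu : u ∈ Y) (huh : G.Adj h u) :
    ∃ S ⊆ Y, (∀ s ∈ S, G.Adj h s) ∧ ConnSet G S ∧ u ∈ S ∧
      ∃ s ∈ S, ∃ d ∈ D, ¬ G.Adj v d ∧ G.Adj s d := by
  let Q : Set V := {d | d ∈ D ∧ ¬ G.Adj v d ∧ ∃ y ∈ Y, G.Adj y d}
  let W : Set V := {x | ∃ S ⊆ Y, (∀ s ∈ S, G.Adj h s) ∧ ConnSet G S ∧ x ∈ S ∧
    ∃ s ∈ S, ∃ d ∈ D, ¬ G.Adj v d ∧ G.Adj s d}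
  by_contra huW
  change u ∉ W at huW
  obtain ⟨q₀, hq₀D, hvq₀, y₀, hy₀, hyq₀⟩ := H.exists_nonadj_attached hv hmix ⟨h, hh, hvh⟩
  have hWY : ∀ x ∈ W, x ∈ Y := by
    rintro x ⟨S, hS, -, -, hx, -⟩
    exact hS hx
  have hWh : ∀ x ∈ W, G.Adj h x := by
    rintro x ⟨S, -, hS, -, hx, -⟩
    exact hS x hx
  have hQh : ∀ q ∈ Q, G.Adj h q := fun q hq =>
    (H.adj_of_mixedOn hG hmix hq.1 hh hq.2.1 hvh).symm
  obtain ⟨T, hT, huT⟩ := exists_isCompOf (G := G) (X := Y \ W) ⟨hu, huW⟩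
  have hTY : ∀ t ∈ T, t ∈ Y := fun t ht => (hT.1 ht).1
  have hTC : ∀ t ∈ T, ∀ c ∈ C, ¬ G.Adj t c := fun t ht c hc =>
    H.not_adj_of_Y_of_C (hTY t ht) hc
  have hTv : ∀ t ∈ T, ¬ G.Adj t v := fun t ht e => H.not_adj_of_A_of_Y hv (hTY t ht) e.symm
  let C₂ : Set V := insert v C ∪ Q ∪ W
  have hC₂ : ConnSet G C₂ := by
    have h1 : ConnSet G (insert v C ∪ Q) := by
      refine H.connC.extend_adj (fun c hc => Or.inl (Or.inr hc)) ?_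
      rintro z ((rfl | hz) | hz) hzC
      · exact hmix.1
      · exact absurd hz hzC
      · obtain ⟨c, hc⟩ := H.connC.nonempty
        exact ⟨c, hc, H.adj_of_D_of_C hz.1 hc⟩
    refine h1.extend Set.subset_union_left ?_
    rintro z (hz | ⟨S, hSY, hSh, hS, hzS, s, hs, d, hd, hvd, hsd⟩) hz'
    · exact absurd hz hz'
    · exact ⟨S, hzS, fun x hx => Or.inr ⟨S, hSY, hSh, hS, hx, s, hs, d, hd, hvd, hsd⟩, hS,
        s, hs, d, Or.inr ⟨hd, hvd, s, hSY hs, hsd⟩, hsd⟩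
  have hTatt : ∃ t ∈ T, ∃ c ∈ C₂, G.Adj t c := by
    by_cases hyT : y₀ ∈ T
    · exact ⟨y₀, hyT, q₀, Or.inl (Or.inr ⟨hq₀D, hvq₀, y₀, hy₀, hyq₀⟩), hyq₀⟩
    · obtain ⟨a, -, haT, b, hb, hbT, hab⟩ := H.connY.exists_leaving (S := T) hu huT hy₀ hyT
      refine ⟨a, haT, b, Or.inr ?_, hab⟩
      by_contra hbW
      exact hbT (hT.mem_of_adj haT ⟨hb, hbW⟩ hab)
  have hTC₂ : ∀ t ∈ T, t ∉ C₂ := by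
    rintro t ht (((rfl | h1) | h1) | h1)
    exacts [H.A_notMem_Y t hv (hTY t ht), H.Y_notMem_C t (hTY t ht) h1,
      H.Y_notMem_D t (hTY t ht) h1.1, (hT.1 ht).2 h1]
  have hhC₂ : ∀ c ∈ C₂, G.Adj h c := by
    rintro c (((rfl | h1) | h1) | h1)
    exacts [hvh.symm, H.adj_of_D_of_C hh h1, hQh c h1, hWh c h1]
  obtain ⟨t, ht, hht, c, hc, htc⟩ := exists_adj_attached hG hC₂ hT.2.1 hTC₂
    (fun hhT => H.Y_notMem_D h (hTY h hhT) hh) hhC₂ ⟨u, huT, huh⟩ hTatt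
    (fun t ht => ⟨v, Or.inl (Or.inl (Or.inl rfl)), hTv t ht⟩)
  refine (hT.1 ht).2 ?_
  rcases hc with ((rfl | hc) | hc) | ⟨S, hSY, hSh, hS, hcS, hSd⟩
  · exact absurd htc (hTv t ht)
  · exact absurd htc (hTC t ht c hc)
  · exact ⟨{t}, Set.singleton_subset_iff.2 (hTY t ht), by rintro _ rfl; exact hht,
      connSet_singleton t, rfl, t, rfl, c, hc.1, hc.2.1, htc⟩
  · obtain ⟨s, hs, hsd⟩ := hSd
    refine ⟨insert t S, Set.insert_subset (hTY t ht) hSY, ?_, ?_, Set.mem_insert t S, s,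
      Set.mem_insert_of_mem t hs, hsd⟩
    · rintro x (rfl | hx)
      exacts [hht, hSh x hx]
    · refine hS.extend_adj (Set.subset_insert t S) ?_
      rintro z (rfl | hz) hzS
      exacts [⟨c, hcS, htc⟩, absurd hz hzS]

/-- If the big components of two fractures meet, and each of the sets `A`, `A'` meets the part
removed by the other fracture, then the big component of one fracture is disjoint from the part
removed by the other. -/
theorem disjoint_removed (hG : HoleWithHatFree G) (H : FractureData G Split A C D Y)
    (H' : FractureData G Split A' C' D' Y') (hA' : ∃ z ∈ A', z ∈ C ∨ z ∈ D)
    (hA : ∃ z ∈ A, z ∈ C' ∨ z ∈ D') (hYY' : ∃ u ∈ Y, u ∈ Y') :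
    ∀ y ∈ Y', y ∉ C ∧ y ∉ D := by
  intro y₀ hy₀
  have hCY' := H.notMem_of_mem_C H' hA'
  refine ⟨fun h => hCY' y₀ h hy₀, fun hy₀D => ?_⟩
  have hCD' : ∀ c ∈ C, c ∈ D' := fun c hc =>
    (H'.Y_closed y₀ hy₀ c (H.adj_of_D_of_C hy₀D hc)).resolve_left (hCY' c hc)
  have hC'D : C' ⊆ D := fun c hc => (H.mem_D c).2
    ⟨fun h => ((H'.mem_D c).1 (hCD' c h)).1 hc,
      fun x hx => (H'.adj_of_D_of_C (hCD' x hx) hc).symm⟩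
  obtain ⟨a, ha, haD'⟩ : ∃ a ∈ A, a ∈ D' := by
    obtain ⟨a, ha, h | h⟩ := hA
    exacts [absurd (hC'D h) (H.A_notMem_D a ha), ⟨a, ha, h⟩]
  obtain ⟨v, hv, hmix, hvC'⟩ := H.exists_mem_A_complete hG H'.anticonnC hC'D
    ⟨a, ha, fun c hc => H'.adj_of_D_of_C haD' hc⟩
  obtain ⟨u₀, hu₀, hu₀'⟩ := hYY'
  obtain ⟨u, huY', hu, y', hy', hy'Y, huy'⟩ := H'.connY.exists_leaving (S := Y) hu₀' hu₀ hy₀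
    (fun h => H.Y_notMem_D y₀ h hy₀D)
  have hy'D : y' ∈ D := (H.Y_closed u hu y' huy').resolve_left hy'Y
  obtain ⟨c', hc'⟩ := H'.connC.nonempty
  obtain ⟨c, hc⟩ := H.connC.nonempty
  have hvy' : G.Adj v y' := by
    by_contra hvy'
    exact H'.not_adj_of_Y_of_C hy' hc'
      (H.adj_of_mixedOn hG hmix hy'D (hC'D hc') hvy' (hvC' c' hc'))
  obtain ⟨S, hSY, hSy', hS, huS, x, hxS, d, hd, hvd, hxd⟩ :=
    H.exists_connSet_attached hG hv hmix hy'D hvy' hu huy'.symm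
  have hSY' : S ⊆ Y' := by
    refine hS.subset_of_closed huS huY' fun x₁ hx₁ hx₁Y' y hy hx₁y => ?_
    by_contra hyY'
    have hyD' := (H'.Y_closed x₁ hx₁Y' y hx₁y).resolve_left hyY'
    exact hG (hasHoleWithHat_of_four (a := y) (b := y') (c := c) (d := c') (x := x₁)
      (hSy' y hy).symm (H.adj_of_D_of_C hy'D hc) (H'.adj_of_D_of_C (hCD' c hc) hc')
      (H'.adj_of_D_of_C hyD' hc').symm (H.not_adj_of_Y_of_C (hSY hy) hc)
      (H'.not_adj_of_Y_of_C hy' hc') hx₁y (hSy' x₁ hx₁).symm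
      (H.not_adj_of_Y_of_C (hSY hx₁) hc) (H'.not_adj_of_Y_of_C hx₁Y' hc'))
  exact hG (hasHoleWithHat_of_four (a := d) (b := y') (c := v) (d := c') (x := x)
    (H.adj_of_mixedOn hG hmix hd hy'D hvd hvy') hvy'.symm (hvC' c' hc')
    (H.adj_of_mixedOn hG hmix hd (hC'D hc') hvd (hvC' c' hc')).symm (fun h => hvd h.symm)
    (H'.not_adj_of_Y_of_C hy' hc') hxd (hSy' x hxS).symm
    (fun h => H.not_adj_of_A_of_Y hv (hSY hxS) h.symm) (H'.not_adj_of_Y_of_C (hSY' hxS) hc'))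

/-- A connected set meeting the big component and disjoint from `C ∪ D` lies in the big
component. -/
theorem subset_of_disjoint_removed (H : FractureData G Split A C D Y) {Z : Set V}
    (hZ : ConnSet G Z) (hYZ : ∃ u ∈ Y, u ∈ Z) (h : ∀ z ∈ Z, z ∉ C ∧ z ∉ D) : Z ⊆ Y := by
  obtain ⟨u, hu, huZ⟩ := hYZ
  exact hZ.subset_of_closed huZ hu fun x _ hxY z hz hxz =>
    (H.Y_closed x hxY z hxz).resolve_right (h z hz).2

/-- A connected subset of `A ∪ Z` not contained in `A` and not contained in `Z` shows that `Z`
meets `C ∪ D`. -/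
theorem exists_mem_removed (H : FractureData G Split A C D Y) {Z P : Set V} (hP : ConnSet G P)
    (hPZ : P ⊆ A ∪ Z) (hPA : ¬ P ⊆ A) (hPZ' : ¬ P ⊆ Z) : ∃ z ∈ Z, z ∈ C ∨ z ∈ D := by
  obtain ⟨x, hx, hxA⟩ := Set.not_subset.1 hPA
  obtain ⟨y, hy, hyZ⟩ := Set.not_subset.1 hPZ'
  obtain ⟨a, -, haA, b, hb, hbA, hab⟩ :=
    hP.exists_leaving (S := A) hy ((hPZ hy).resolve_right hyZ) hx hxA
  exact ⟨b, (hPZ hb).resolve_left hbA, (H.A_closed a haA b hab).resolve_left hbA⟩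

end FractureData

end Fractures

theorem statement_12 {V : Type} [Fintype V] (G : SimpleGraph V) (w : V → ℝ) (ε : ℝ)
    (hε : 0 < ε) (h6 : 6 * ε ≤ 1) (hw : IsWeight w) (hcoh : Coherent G w ε)
    (hG : HoleWithHatFree G) (A C D B A' C' D' B' : Set V)
    (hfrac : IsFracture G w ε A C D B) (hfrac' : IsFracture G w ε A' C' D' B') :
    (∀ P : Set V, P ⊆ A ∪ A' → ConnSet G P → P ⊆ A ∨ P ⊆ A') ∨
    (∀ Y Y' : Set V, IsBigComp G w ε ((C ∪ D)ᶜ) Y →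
      IsBigComp G w ε ((C' ∪ D')ᶜ) Y' → Y = Y') := by
  refine or_iff_not_imp_left.2 fun hP Y Y' hY hY' => ?_
  push Not at hP
  obtain ⟨P, hPAA', hPc, hPA, hPA'⟩ := hP
  obtain ⟨H, hYw⟩ := hfrac.fractureData h6 hw hcoh hY
  obtain ⟨H', hYw'⟩ := hfrac'.fractureData h6 hw hcoh hY'
  obtain ⟨u, hu, hu'⟩ := exists_mem_of_setSum_add hw (X := Y) (Y := Y') (by linarith)
  have hA' := H.exists_mem_removed hPc hPAA' hPA hPA'
  have hA := H'.exists_mem_removed hPc (Set.union_comm A A' ▸ hPAA') hPA' hPA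
  exact (H'.subset_of_disjoint_removed H.connY ⟨u, hu', hu⟩
    (H'.disjoint_removed hG H hA hA' ⟨u, hu', hu⟩)).antisymm
    (H.subset_of_disjoint_removed H'.connY ⟨u, hu, hu'⟩
      (H.disjoint_removed hG H' hA' hA ⟨u, hu, hu'⟩))

end EHhat
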